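/- arXiv:2503.19453 — 3 statements merged into one kernel-verified Lean document; each statement's English description precedes it below -/
import Mathlib

section
/- Let A be a real n×n doubly stochastic matrix (with n ≥ 1) such that A^k converges entrywise to (1/n)·𝟙𝟙ᵀ as k → ∞. Let T ≥ 1 and let x, η : ℕ → ℝ^n be sequences satisfying x^{(k+1)} = A·(x^{(k)} + η^{(k+1)}) for all k, where the noise satisfies η^{(T)} = −∑_{j=1}^{T-1} η^{(j)} and η^{(k)} = 0 for all k > T. Then x^{(k)} converges, as k → ∞, to the vector all of whose entries equal (1/n)·∑_i x_i^{(0)}, i.e., the agents reach exact average consensus on their initial states despite the injected noise. -/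
open Matrix Filter Finset

theorem sum_mulVec_of_col_sum_eq_one {ι : Type*} [Fintype ι] {A : Matrix ι ι ℝ}
    (hcol : ∀ j, ∑ i, A i j = 1) (v : ι → ℝ) : ∑ i, A.mulVec v i = ∑ i, v i := by
  simp only [Matrix.mulVec, dotProduct]
  rw [Finset.sum_comm]
  simp [← Finset.sum_mul, hcol]

theorem sum_noisy_iterate {ι : Type*} [Fintype ι] {A : Matrix ι ι ℝ}
    (hcol : ∀ j, ∑ i, A i j = 1) {x η : ℕ → ι → ℝ}
    (hx : ∀ k, x (k + 1) = A.mulVec (x k + η (k + 1))) (k : ℕ) :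
    ∑ i, x k i = ∑ i, x 0 i + ∑ i, (∑ j ∈ Finset.Icc 1 k, η j) i := by
  induction k with
  | zero => simp
  | succ k ih =>
    rw [hx, sum_mulVec_of_col_sum_eq_one hcol, Finset.sum_Icc_succ_top (by omega)]
    simp only [Pi.add_apply, Finset.sum_add_distrib]
    rw [ih]
    ring

theorem iterate_eq_pow_mulVec {ι : Type*} [Fintype ι] [DecidableEq ι] {A : Matrix ι ι ℝ}
    {x η : ℕ → ι → ℝ} (hx : ∀ k, x (k + 1) = A.mulVec (x k + η (k + 1)))
    {T : ℕ} (hη : ∀ k, T < k → η k = 0) (m : ℕ) :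
    x (m + T) = (A ^ m).mulVec (x T) := by
  induction m with
  | zero => simp
  | succ m ih =>
    rw [show m + 1 + T = m + T + 1 by omega, hx, hη _ (by omega), add_zero, ih,
      Matrix.mulVec_mulVec, pow_succ']

theorem noisy_average_consensus (n : ℕ) (hn : 1 ≤ n)
    (A : Matrix (Fin n) (Fin n) ℝ)
    (hnn : ∀ i j, 0 ≤ A i j)
    (hrow : ∀ i, ∑ j, A i j = 1) (hcol : ∀ j, ∑ i, A i j = 1)
    (hpow : ∀ i j, Filter.Tendsto (fun k => (A ^ k) i j) Filter.atTop (nhds ((n : ℝ)⁻¹)))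
    (T : ℕ) (hT : 1 ≤ T)
    (x η : ℕ → Fin n → ℝ)
    (hx : ∀ k, x (k + 1) = A.mulVec (x k + η (k + 1)))
    (hηT : η T = -∑ j ∈ Finset.Icc 1 (T - 1), η j)
    (hηpost : ∀ k, T < k → η k = 0) :
    ∀ i, Filter.Tendsto (fun k => x k i) Filter.atTop
      (nhds ((n : ℝ)⁻¹ * ∑ j, x 0 j)) := by
  intro i
  have hsum : ∑ j, x T j = ∑ j, x 0 j := by
    obtain ⟨S, rfl⟩ : ∃ S, T = S + 1 := ⟨T - 1, by omega⟩
    rw [sum_noisy_iterate hcol hx, Finset.sum_Icc_succ_top (by omega), hηT]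
    simp
  rw [← tendsto_add_atTop_iff_nat T, ← hsum, Finset.mul_sum]
  simp only [iterate_eq_pow_mulVec hx hηpost, Matrix.mulVec, dotProduct]
  exact tendsto_finsetSum _ fun j _ => (hpow i j).mul_const _
end

section
/- Let A be a real n×n doubly stochastic matrix (n ≥ 1) that is primitive, i.e., there exists m ≥ 1 such that every entry of A^m is strictly positive. Then A^k converges entrywise to (1/n)·𝟙𝟙ᵀ as k → ∞. -/
open Matrix Filter

/-- Left multiplication by a row stochastic matrix with entries at least `ε` contracts the
deviation of the entries from `1 / |ι|` by the factor `1 - |ι| ε`, provided the columns of the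
right factor sum to `1`. -/
lemma abs_mul_apply_sub_inv_card_le {ι : Type*} [Fintype ι] [Nonempty ι]
    {P B : Matrix ι ι ℝ} {ε c : ℝ} (hε : ∀ i j, ε ≤ P i j) (hP : ∀ i, ∑ j, P i j = 1)
    (hB : ∀ j, ∑ i, B i j = 1) (hc : ∀ i j, |B i j - (Fintype.card ι : ℝ)⁻¹| ≤ c) (i j : ι) :
    |(P * B) i j - (Fintype.card ι : ℝ)⁻¹| ≤ (1 - Fintype.card ι * ε) * c := by
  have hcard : (Fintype.card ι : ℝ) ≠ 0 := Nat.cast_ne_zero.mpr Fintype.card_ne_zero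
  have key : (P * B) i j - (Fintype.card ι : ℝ)⁻¹
      = ∑ k, (P i k - ε) * (B k j - (Fintype.card ι : ℝ)⁻¹) := by
    simp only [Matrix.mul_apply, sub_mul, mul_sub, Finset.sum_sub_distrib, ← Finset.sum_mul,
      ← Finset.mul_sum, hP, hB, Finset.sum_const, Finset.card_univ, nsmul_eq_mul]
    field_simp
    ring
  calc |(P * B) i j - (Fintype.card ι : ℝ)⁻¹|
      ≤ ∑ k, |(P i k - ε) * (B k j - (Fintype.card ι : ℝ)⁻¹)| :=
        key ▸ Finset.abs_sum_le_sum_abs _ _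
    _ ≤ ∑ k, (P i k - ε) * c := by
        refine Finset.sum_le_sum fun k _ => ?_
        have hk : 0 ≤ P i k - ε := sub_nonneg.mpr (hε i k)
        rw [abs_mul, abs_of_nonneg hk]
        exact mul_le_mul_of_nonneg_left (hc k j) hk
    _ = (1 - Fintype.card ι * ε) * c := by
        simp [← Finset.sum_mul, Finset.sum_sub_distrib, hP]

/-- The entries of a doubly stochastic matrix differ from `1 / |ι|` by at most `1`. -/
lemma abs_sub_inv_card_le_one_of_mem_doublyStochastic {ι : Type*} [Fintype ι] [DecidableEq ι]
    {M : Matrix ι ι ℝ} (hM : M ∈ doublyStochastic ℝ ι) (i j : ι) :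
    |M i j - (Fintype.card ι : ℝ)⁻¹| ≤ 1 := by
  have h0 := nonneg_of_mem_doublyStochastic hM (i := i) (j := j)
  have h1 := le_one_of_mem_doublyStochastic hM (i := i) (j := j)
  have h2 : (0 : ℝ) ≤ (Fintype.card ι : ℝ)⁻¹ := by positivity
  have h3 : (Fintype.card ι : ℝ)⁻¹ ≤ 1 := Nat.cast_inv_le_one _
  rw [abs_le]
  constructor <;> linarith

theorem primitive_doubly_stochastic_pow_tendsto (n : ℕ) (hn : 1 ≤ n)
    (A : Matrix (Fin n) (Fin n) ℝ)
    (hnn : ∀ i j, 0 ≤ A i j)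
    (hrow : ∀ i, ∑ j, A i j = 1) (hcol : ∀ j, ∑ i, A i j = 1)
    (hprim : ∃ m, 1 ≤ m ∧ ∀ i j, 0 < (A ^ m) i j) :
    ∀ i j, Filter.Tendsto (fun k => (A ^ k) i j) Filter.atTop
      (nhds ((n : ℝ)⁻¹)) := by
  intro i j
  obtain ⟨m, hm, hpos⟩ := hprim
  have : Nonempty (Fin n) := ⟨i⟩
  have hA (k : ℕ) : A ^ k ∈ doublyStochastic ℝ (Fin n) :=
    pow_mem (mem_doublyStochastic_iff_sum.mpr ⟨hnn, hrow, hcol⟩) k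
  obtain ⟨p, hp⟩ := Finite.exists_min fun p : Fin n × Fin n => (A ^ m) p.1 p.2
  set ε := (A ^ m) p.1 p.2
  have hε : 0 < ε := hpos _ _
  have hle (i j) : ε ≤ (A ^ m) i j := hp (i, j)
  have hnε : n * ε ≤ 1 := by
    calc n * ε = ∑ _k : Fin n, ε := by simp
      _ ≤ ∑ k, (A ^ m) i k := Finset.sum_le_sum fun k _ => hle i k
      _ = 1 := sum_row_of_mem_doublyStochastic (hA m) i
  have bound (q r : ℕ) : ∀ i j, |(A ^ (m * q + r)) i j - (n : ℝ)⁻¹| ≤ (1 - n * ε) ^ q := by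
    induction q with
    | zero => simpa using abs_sub_inv_card_le_one_of_mem_doublyStochastic (hA r)
    | succ q ih =>
      intro i j
      have h := abs_mul_apply_sub_inv_card_le hle (sum_row_of_mem_doublyStochastic (hA m))
        (sum_col_of_mem_doublyStochastic (hA (m * q + r))) (by simpa using ih) i j
      rw [Fintype.card_fin, ← pow_add, ← pow_succ'] at h
      rwa [show m * (q + 1) + r = m + (m * q + r) by ring]
  have hlim : Tendsto (fun k : ℕ => (1 - n * ε) ^ (k / m)) atTop (nhds 0) := by
    have hn0 : (0 : ℝ) < n := by exact_mod_cast hn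
    exact (tendsto_pow_atTop_nhds_zero_of_lt_one (by linarith)
      (by linarith [mul_pos hn0 hε])).comp (Nat.tendsto_div_const_atTop (by lia))
  rw [tendsto_iff_dist_tendsto_zero]
  refine squeeze_zero (fun _ => dist_nonneg) (fun k => ?_) hlim
  rw [Real.dist_eq]
  simpa only [Nat.div_add_mod] using bound (k / m) (k % m) i j
end

section
/- Let G be a connected finite simple graph on vertex set Fin n with n ≥ 1 and Metropolis weight matrix W. Let T ≥ 1 and let x, η : ℕ → ℝ^n be sequences satisfying x^{(k+1)} = W·(x^{(k)} + η^{(k+1)}) for all k, where the noise satisfies η^{(T)} = −∑_{j=1}^{T-1} η^{(j)} and η^{(k)} = 0 for all k > T. Then x^{(k)} converges, as k → ∞, to the vector all of whose entries equal (1/n)·∑_i x_i^{(0)}. -/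
open Matrix Finset Filter

/-- The Metropolis weight matrix of a finite simple graph on `Fin n`:
with `m = 1 + max_i deg(i)`, the off-diagonal entries are `Adj i j / m`
and the diagonal entries are `(m - deg(i)) / m`. -/
noncomputable def metropolisWeights {n : ℕ} (G : SimpleGraph (Fin n)) [DecidableRel G.Adj] :
    Matrix (Fin n) (Fin n) ℝ :=
  Matrix.of fun i j =>
    if i = j then
      (((1 + Finset.univ.sup fun v => G.degree v : ℕ) : ℝ) - (G.degree i : ℝ)) /
        ((1 + Finset.univ.sup fun v => G.degree v : ℕ) : ℝ)
    else
      (if G.Adj i j then (1 : ℝ) else 0) /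
        ((1 + Finset.univ.sup fun v => G.degree v : ℕ) : ℝ)

/-- A doubly stochastic matrix decreases the sum of squares by a weighted sum of squared
deviations. -/
theorem sum_sq_sub_sum_sq_mulVec {V : Type*} [Fintype V] [DecidableEq V] {W : Matrix V V ℝ}
    (hW : W ∈ doublyStochastic ℝ V) (v : V → ℝ) :
    ∑ j, v j ^ 2 - ∑ i, (W *ᵥ v) i ^ 2 = ∑ i, ∑ j, W i j * (v j - (W *ᵥ v) i) ^ 2 := by
  have h_row (i : V) : ∑ j, W i j * (v j - (W *ᵥ v) i) ^ 2 =
      ∑ j, W i j * v j ^ 2 - (W *ᵥ v) i ^ 2 := by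
    have h_mean : ∑ j, W i j * v j = (W *ᵥ v) i := rfl
    calc
      _ = ∑ j, W i j * v j ^ 2 - 2 * (W *ᵥ v) i * ∑ j, W i j * v j +
          (W *ᵥ v) i ^ 2 * ∑ j, W i j := by
        simp only [mul_sum, ← sum_sub_distrib, ← sum_add_distrib]
        exact sum_congr rfl fun j _ => by ring
      _ = _ := by
        rw [h_mean, sum_row_of_mem_doublyStochastic hW]
        ring
  simp only [h_row, sum_sub_distrib]
  rw [sum_comm]
  simp only [← sum_mul, sum_col_of_mem_doublyStochastic hW, one_mul]

/-- Along the iteration of a doubly stochastic matrix, each entry approaches the next value at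
every vertex that gives it positive weight. -/
theorem tendsto_sub_of_doublyStochastic {V : Type*} [Fintype V] [DecidableEq V]
    {W : Matrix V V ℝ} (hW : W ∈ doublyStochastic ℝ V) {y : ℕ → V → ℝ}
    (hy : ∀ k, y (k + 1) = W *ᵥ y k) {i j : V} (hij : 0 < W i j) :
    Tendsto (fun k => y k j - y (k + 1) i) atTop (nhds 0) := by
  have h_nonneg (k : ℕ) (a b : V) : 0 ≤ W a b * (y k b - y (k + 1) a) ^ 2 :=
    mul_nonneg (nonneg_of_mem_doublyStochastic hW) (sq_nonneg _)
  have h_energy (k : ℕ) : ∑ a, y k a ^ 2 - ∑ a, y (k + 1) a ^ 2 =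
      ∑ a, ∑ b, W a b * (y k b - y (k + 1) a) ^ 2 := by
    rw [hy k]
    exact sum_sq_sub_sum_sq_mulVec hW (y k)
  have h_anti : Antitone fun k => ∑ a, y k a ^ 2 := antitone_nat_of_succ_le fun k => by
    rw [← sub_nonneg, h_energy]
    exact sum_nonneg fun a _ => sum_nonneg fun b _ => h_nonneg k a b
  have h_lim := tendsto_atTop_ciInf h_anti
    ⟨0, by rintro _ ⟨k, rfl⟩; exact sum_nonneg fun a _ => sq_nonneg _⟩
  have h_diff := h_lim.sub (h_lim.comp (tendsto_add_atTop_nat 1))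
  rw [sub_self] at h_diff
  have h_term : Tendsto (fun k => W i j * (y k j - y (k + 1) i) ^ 2) atTop (nhds 0) := by
    refine squeeze_zero (fun k => h_nonneg k i j) (fun k => ?_) h_diff
    refine le_trans ?_ (h_energy k).ge
    exact (single_le_sum (f := fun b => W i b * (y k b - y (k + 1) i) ^ 2)
      (fun b _ => h_nonneg k i b) (mem_univ j)).trans
      (single_le_sum (f := fun a => ∑ b, W a b * (y k b - y (k + 1) a) ^ 2)
        (fun a _ => sum_nonneg fun b _ => h_nonneg k a b) (mem_univ i))
  have h_sq : Tendsto (fun k => (y k j - y (k + 1) i) ^ 2) atTop (nhds 0) := by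
    simpa [inv_mul_cancel_left₀ hij.ne'] using h_term.const_mul (W i j)⁻¹
  rw [tendsto_zero_iff_abs_tendsto_zero]
  simpa [Function.comp_def, Real.sqrt_sq_eq_abs] using h_sq.sqrt

/-- Iterating a doubly stochastic matrix with positive weights on the diagonal and on the edges
of a connected graph yields average consensus. -/
theorem tendsto_average_of_doublyStochastic {V : Type*} [Fintype V] [DecidableEq V]
    {G : SimpleGraph V} (hG : G.Connected) {W : Matrix V V ℝ} (hW : W ∈ doublyStochastic ℝ V)
    (h_diag : ∀ i, 0 < W i i) (h_adj : ∀ i j, G.Adj i j → 0 < W i j) {y : ℕ → V → ℝ}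
    (hy : ∀ k, y (k + 1) = W *ᵥ y k) (i : V) :
    Tendsto (fun k => y k i) atTop (nhds ((Fintype.card V : ℝ)⁻¹ * ∑ j, y 0 j)) := by
  have h_sum (k : ℕ) : ∑ j, y k j = ∑ j, y 0 j := by
    induction k with
    | zero => rfl
    | succ k ih => rw [hy, sum_mulVec_of_mem_doublyStochastic hW, ih]
  have h_edge (a b : V) (hab : G.Adj a b) :
      Tendsto (fun k => y k a - y k b) atTop (nhds 0) := by
    simpa using (tendsto_sub_of_doublyStochastic hW hy (h_diag a)).sub
      (tendsto_sub_of_doublyStochastic hW hy (h_adj a b hab))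
  have h_pair (a b : V) : Tendsto (fun k => y k a - y k b) atTop (nhds 0) := by
    obtain ⟨p⟩ := hG.preconnected a b
    induction p with
    | nil => simp
    | cons hab _ ih => simpa using (h_edge _ _ hab).add ih
  have h_card : (Fintype.card V : ℝ) ≠ 0 :=
    Nat.cast_ne_zero.mpr (Fintype.card_pos_iff.mpr ⟨i⟩).ne'
  have h_dev : Tendsto (fun k => (Fintype.card V : ℝ)⁻¹ * (∑ j, y 0 j + ∑ j, (y k i - y k j)))
      atTop (nhds ((Fintype.card V : ℝ)⁻¹ * (∑ j, y 0 j + ∑ _j : V, 0))) :=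
    (tendsto_const_nhds.add (tendsto_finsetSum _ fun j _ => h_pair i j)).const_mul _
  rw [sum_const_zero, add_zero] at h_dev
  refine h_dev.congr fun k => ?_
  rw [sum_sub_distrib, h_sum k, sum_const, card_univ, nsmul_eq_mul, add_sub_cancel,
    inv_mul_cancel_left₀ h_card]

theorem metropolisWeights_diag_pos {n : ℕ} (G : SimpleGraph (Fin n)) [DecidableRel G.Adj]
    (i : Fin n) : 0 < metropolisWeights G i i := by
  have h_deg : G.degree i < 1 + Finset.univ.sup fun v => G.degree v := by
    have := le_sup (f := fun v => G.degree v) (mem_univ i)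
    omega
  simp only [metropolisWeights, of_apply, if_true]
  exact div_pos (sub_pos.mpr (Nat.cast_lt.mpr h_deg)) (by positivity)

theorem metropolisWeights_pos_of_adj {n : ℕ} (G : SimpleGraph (Fin n)) [DecidableRel G.Adj]
    (i j : Fin n) (hij : G.Adj i j) : 0 < metropolisWeights G i j := by
  simp only [metropolisWeights, of_apply, if_neg hij.ne, if_pos hij]
  positivity

theorem metropolisWeights_isSymm {n : ℕ} (G : SimpleGraph (Fin n)) [DecidableRel G.Adj] :
    (metropolisWeights G).IsSymm := by
  ext i j
  by_cases hij : i = j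
  · subst hij
    rfl
  · simp [metropolisWeights, hij, Ne.symm hij, G.adj_comm]

theorem metropolisWeights_row_sum {n : ℕ} (G : SimpleGraph (Fin n)) [DecidableRel G.Adj]
    (i : Fin n) : ∑ j, metropolisWeights G i j = 1 := by
  set m : ℝ := ((1 + Finset.univ.sup fun v => G.degree v : ℕ) : ℝ) with hm
  have h_pos : 0 < m := by positivity
  have h_entry (j : Fin n) : metropolisWeights G i j =
      (if i = j then (m - G.degree i) / m else 0) + (if G.Adj i j then 1 else 0) / m := by
    by_cases hij : i = j
    · subst hij
      simp [metropolisWeights, hm]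
    · simp [metropolisWeights, hm, hij]
  simp only [h_entry, sum_add_distrib, sum_ite_eq, mem_univ, if_true, ← sum_div, sum_boole]
  rw [← G.neighborFinset_eq_filter, G.card_neighborFinset_eq_degree]
  field_simp
  ring

theorem metropolisWeights_mem_doublyStochastic {n : ℕ} (G : SimpleGraph (Fin n))
    [DecidableRel G.Adj] : metropolisWeights G ∈ doublyStochastic ℝ (Fin n) := by
  rw [mem_doublyStochastic_iff_sum]
  refine ⟨fun i j => ?_, metropolisWeights_row_sum G, fun j => ?_⟩
  · by_cases hij : i = j
    · subst hij
      exact (metropolisWeights_diag_pos G i).le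
    · simp only [metropolisWeights, of_apply, if_neg hij]
      positivity
  · simpa only [(metropolisWeights_isSymm G).apply] using metropolisWeights_row_sum G j

theorem metropolis_noisy_average_consensus (n : ℕ) (hn : 1 ≤ n)
    (G : SimpleGraph (Fin n)) [DecidableRel G.Adj] (hconn : G.Connected)
    (T : ℕ) (hT : 1 ≤ T)
    (x η : ℕ → Fin n → ℝ)
    (hx : ∀ k, x (k + 1) = (metropolisWeights G).mulVec (x k + η (k + 1)))
    (hηT : η T = -∑ j ∈ Finset.Icc 1 (T - 1), η j)
    (hηpost : ∀ k, T < k → η k = 0) :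
    ∀ i, Filter.Tendsto (fun k => x k i) Filter.atTop
      (nhds ((n : ℝ)⁻¹ * ∑ j, x 0 j)) := by
  have hW := metropolisWeights_mem_doublyStochastic G
  have h_sum (k : ℕ) : ∑ i, x k i = ∑ i, x 0 i + ∑ i, (∑ j ∈ Icc 1 k, η j) i := by
    induction k with
    | zero => simp
    | succ k ih =>
      rw [hx, sum_mulVec_of_mem_doublyStochastic hW, sum_Icc_succ_top (by omega)]
      simp only [Pi.add_apply, sum_add_distrib, ih, add_assoc]
  have h_noise : ∑ j ∈ Icc 1 T, η j = 0 := by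
    obtain ⟨t, rfl⟩ := Nat.exists_eq_add_of_le' hT
    rw [sum_Icc_succ_top (by omega), hηT, Nat.add_sub_cancel, add_neg_cancel]
  have h_step (k : ℕ) : x (k + 1 + T) = metropolisWeights G *ᵥ x (k + T) := by
    rw [Nat.add_right_comm, hx, hηpost _ (by omega), add_zero]
  intro i
  have h_lim := tendsto_average_of_doublyStochastic hconn hW (metropolisWeights_diag_pos G)
    (metropolisWeights_pos_of_adj G) (y := fun k => x (k + T)) h_step i
  rw [← tendsto_add_atTop_iff_nat T]
  simpa only [Fintype.card_fin, zero_add, h_sum T, h_noise, Pi.zero_apply, sum_const_zero,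
    add_zero] using h_lim
end
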